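/- There exist absolute constants c, C > 0 such that for every sufficiently large real L ≥ 2 the following holds: if G is an n-vertex graph with average degree d(G) ≥ d and maximum degree Δ(G) ≤ L·d, then G has an induced subgraph H with Δ(H) ≤ C·d(H)·(log₂ L)² and average degree d(H) ≥ c·d/(log₂ L)². -/

import Mathlib

open Finset

/-- The average degree `2|E|/|V|` of a finite simple graph. -/
noncomputable def avgDeg {V : Type*} [Fintype V] (G : SimpleGraph V) : ℝ :=
  2 * G.edgeSet.ncard / Fintype.card V

/-- The degree of a vertex. -/
noncomputable def deg {V : Type*} (G : SimpleGraph V) (v : V) : ℕ :=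
  (G.neighborSet v).ncard

/-- `G` contains `K_{s,s}` as a (not necessarily induced) subgraph. -/
def HasKssSubgraph {V : Type*} (G : SimpleGraph V) (s : ℕ) : Prop :=
  ∃ f : completeBipartiteGraph (Fin s) (Fin s) →g G, Function.Injective f

/-- `G` contains no cycle of length 4, even as a non-induced subgraph. -/
def C4Free {V : Type*} (G : SimpleGraph V) : Prop :=
  ¬ ∃ a b c d : V, a ≠ b ∧ a ≠ c ∧ a ≠ d ∧ b ≠ c ∧ b ≠ d ∧ c ≠ d ∧
      G.Adj a b ∧ G.Adj b c ∧ G.Adj c d ∧ G.Adj d a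

/-- The balanced subdivision of `K_h` in which every edge of `K_h` is replaced by a
path with exactly `ℓ` edges (intended for `ℓ ≥ 2`): branch vertices are `Fin h`,
and each pair `a < b` gets a path of `ℓ - 1` new internal vertices. -/
def balancedSubdivision (h ℓ : ℕ) :
    SimpleGraph (Fin h ⊕ ({p : Fin h × Fin h // p.1 < p.2} × Fin (ℓ - 1))) :=
  SimpleGraph.fromRel (fun x y =>
    match x, y with
    | Sum.inl u, Sum.inr ⟨⟨⟨a, b⟩, _⟩, i⟩ => (u = a ∧ (i : ℕ) = 0) ∨ (u = b ∧ (i : ℕ) = ℓ - 2)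
    | Sum.inr ⟨e, i⟩, Sum.inr ⟨e', j⟩ => e = e' ∧ (j : ℕ) = (i : ℕ) + 1
    | _, _ => False)

/-- `G` contains an induced proper balanced subdivision of `K_h`. -/
def HasInducedBalancedSubdivision {V : Type*} (G : SimpleGraph V) (h : ℕ) : Prop :=
  ∃ ℓ : ℕ, 2 ≤ ℓ ∧ Nonempty (balancedSubdivision h ℓ ↪g G)

/-- The number of edges of `G` with one endpoint in `A` and the other in `B`
(for disjoint `A`, `B`). -/
noncomputable def crossEdges {V : Type*} (G : SimpleGraph V) (A B : Set V) : ℕ :=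
  Set.ncard {p : V × V | p.1 ∈ A ∧ p.2 ∈ B ∧ G.Adj p.1 p.2}

/-- `G` is `d`-degenerate: every (induced) subgraph has a vertex of degree at most `d`. -/
def Degenerate {V : Type*} (G : SimpleGraph V) (d : ℕ) : Prop :=
  ∀ s : Finset V, s.Nonempty → ∃ v ∈ s, ((s : Set V) ∩ G.neighborSet v).ncard ≤ d

/-- The 1-subdivision of the multihypergraph with hyperedges `edges e`, `e : E`,
on vertex set `V`. -/
def oneSubdivision {E V : Type*} (edges : E → Finset V) : SimpleGraph (E ⊕ V) :=
  SimpleGraph.fromRel (fun x y =>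
    match x, y with
    | Sum.inl a, Sum.inr b => b ∈ edges a
    | _, _ => False)

/-- The 1-subdivision of a simple graph `G`. -/
def graphOneSubdivision {W : Type*} (G : SimpleGraph W) : SimpleGraph (G.edgeSet ⊕ W) :=
  SimpleGraph.fromRel (fun x y =>
    match x, y with
    | Sum.inl e, Sum.inr w => w ∈ (e : Sym2 W)
    | _, _ => False)

/-- `I` is an independent set of `G`. -/
def IndepSet {V : Type*} (G : SimpleGraph V) (I : Set V) : Prop :=
  I.Pairwise fun u v => ¬ G.Adj u v

/-- `G` has a clique on `k` vertices. -/
def HasClique {V : Type*} (G : SimpleGraph V) (k : ℕ) : Prop :=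
  ∃ t : Finset V, G.IsNClique k t


open scoped Classical in
/-- The number of neighbours of `v` in `T`. -/
noncomputable def degIn {V : Type*} (G : SimpleGraph V) (v : V) (T : Finset V) : ℕ :=
  #{u ∈ T | G.Adj v u}

section DegIn

variable {V : Type*} (G : SimpleGraph V)

lemma degIn_mono (v : V) {S T : Finset V} (h : S ⊆ T) : degIn G v S ≤ degIn G v T := by
  classical
  exact card_le_card (filter_subset_filter _ h)

lemma degIn_union_le [DecidableEq V] (v : V) (S T : Finset V) :
    degIn G v (S ∪ T) ≤ degIn G v S + degIn G v T := by
  classical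
  unfold degIn
  rw [filter_union]
  exact card_union_le _ _

lemma deg_induce (s : Finset V) (v : (s : Set V)) :
    deg (G.induce (s : Set V)) v = degIn G v s := by
  classical
  unfold deg degIn
  rw [← Set.ncard_coe_finset, ← Set.ncard_image_of_injective _ Subtype.val_injective]
  congr 1
  ext u
  simp [and_comm]

lemma deg_eq_degIn [Fintype V] (v : V) : deg G v = degIn G v univ := by
  classical
  unfold deg degIn
  rw [← Set.ncard_coe_finset]
  congr 1
  ext u
  simp

lemma sum_deg [Fintype V] : ∑ v, deg G v = 2 * G.edgeSet.ncard := by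
  classical
  have h := G.sum_degrees_eq_twice_card_edges
  rw [← SimpleGraph.coe_edgeFinset, Set.ncard_coe_finset, ← h]
  refine sum_congr rfl fun v _ => ?_
  rw [deg, Set.ncard_eq_toFinset_card', ← SimpleGraph.neighborFinset,
    SimpleGraph.card_neighborFinset_eq_degree]

lemma avgDeg_eq [Fintype V] : avgDeg G = (∑ v, degIn G v univ : ℕ) / (Fintype.card V : ℝ) := by
  simp_rw [← deg_eq_degIn, sum_deg, avgDeg]
  push_cast
  rfl

lemma avgDeg_induce (s : Finset V) :
    avgDeg (G.induce (s : Set V)) = (∑ v ∈ s, degIn G v s : ℕ) / (#s : ℝ) := by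
  have h := sum_deg (G.induce (s : Set V))
  simp_rw [deg_induce] at h
  have h' : ∑ v ∈ s, degIn G v s = ∑ v : (s : Set V), degIn G v s :=
    (sum_coe_sort s fun v => degIn G v s).symm
  rw [h', h, avgDeg]
  simp

lemma sum_degIn_erase [DecidableEq V] {s : Finset V} {v : V} (hv : v ∈ s) :
    ∑ u ∈ s, degIn G u s = ∑ u ∈ s.erase v, degIn G u (s.erase v) + 2 * degIn G v s := by
  classical
  have h1 : ∀ u, degIn G u s = degIn G u (s.erase v) + if G.Adj u v then 1 else 0 := by
    intro u
    simp only [degIn, card_filter]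
    rw [sum_erase_add _ _ hv]
  have h2 : ∑ u ∈ s.erase v, (if G.Adj u v then 1 else 0) = degIn G v s := by
    rw [h1 v]
    simp only [degIn, card_filter, G.adj_comm v, G.irrefl, if_false, add_zero]
  rw [← sum_erase_add _ _ hv, sum_congr rfl fun u _ => h1 u, sum_add_distrib, h2]
  ring

/-- A nonempty induced subgraph of maximum average degree has minimum degree at least half of
its average degree. -/
lemma exists_max_average [Fintype V] [Nonempty V] :
    ∃ W : Finset V, W.Nonempty ∧ ∃ δ : ℝ, avgDeg G ≤ δ ∧
      (∑ v ∈ W, degIn G v W : ℕ) = δ * #W ∧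
      (∀ T : Finset V, (∑ v ∈ T, degIn G v T : ℕ) ≤ δ * #T) ∧
      ∀ v ∈ W, δ / 2 ≤ degIn G v W := by
  classical
  let f : Finset V → ℝ := fun T => (∑ v ∈ T, degIn G v T : ℕ) / (#T : ℝ)
  obtain ⟨W, hW, hmax⟩ := exists_max_image ({T | T.Nonempty} : Finset (Finset V)) f
    ⟨univ, by simp⟩
  simp only [mem_filter, mem_univ, true_and] at hW hmax
  have hWpos : (0 : ℝ) < #W := by exact_mod_cast hW.card_pos
  have hT : ∀ T : Finset V, ((∑ v ∈ T, degIn G v T : ℕ) : ℝ) ≤ f W * #T := by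
    intro T
    rcases T.eq_empty_or_nonempty with rfl | hne
    · simp
    · have := hmax T hne
      have hpos : (0 : ℝ) < #T := by exact_mod_cast hne.card_pos
      rwa [div_le_iff₀ hpos] at this
  have hWeq : ((∑ v ∈ W, degIn G v W : ℕ) : ℝ) = f W * #W := (div_mul_cancel₀ _ hWpos.ne').symm
  refine ⟨W, hW, f W, ?_, hWeq, hT, fun v hv => ?_⟩
  · rw [avgDeg_eq]
    exact hmax univ univ_nonempty
  · have h1 := sum_degIn_erase G hv
    have h2 := hT (W.erase v)
    have h3 : (#(W.erase v) : ℝ) = #W - 1 := by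
      rw [card_erase_of_mem hv, Nat.cast_sub hW.card_pos, Nat.cast_one]
    rw [h1, Nat.cast_add, Nat.cast_mul] at hWeq
    rw [h3] at h2
    push_cast at hWeq h2
    linarith

end DegIn

section Sampling

lemma card_functions_eq_zero_on {α : Type*} [Fintype α] [DecidableEq α] (N : ℕ) [NeZero N]
    (t : Finset α) :
    (#{f : α → Fin N | ∀ u ∈ t, f u = 0} : ℝ) * N ^ #t = N ^ Fintype.card α := by
  have h : ({f : α → Fin N | ∀ u ∈ t, f u = 0} : Finset _) =
      Fintype.piFinset fun u => if u ∈ t then ({0} : Finset (Fin N)) else univ := by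
    ext f
    simp only [mem_filter, mem_univ, true_and, Fintype.mem_piFinset]
    refine forall_congr' fun u => ?_
    by_cases hu : u ∈ t <;> simp [hu]
  have h' : ∀ u, #(if u ∈ t then ({0} : Finset (Fin N)) else univ) = if u ∈ t then 1 else N := by
    intro u
    split_ifs <;> simp
  rw [h, Fintype.card_piFinset]
  simp only [h']
  rw [prod_ite]
  simp only [prod_const_one, one_mul, prod_const]
  norm_cast
  rw [← pow_add, filter_not, filter_mem_eq_inter, univ_inter, card_sdiff_of_subset (subset_univ _),
    card_univ, Nat.sub_add_cancel (card_le_univ _)]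

/-- Sampling each element of `A` with probability `1 / N` keeps, in expectation, at least half of
the expected number of incidences, even after discarding the sets `M v` met more than `T` times. -/
lemma exists_sample {α β : Type*} [Fintype α] [DecidableEq α] (A : Finset α) (B : Finset β)
    (M : β → Finset α) (hM : ∀ v ∈ B, M v ⊆ A) (N : ℕ) [NeZero N] (T : ℕ) (hT : 0 < T)
    (hD : ∀ v ∈ B, (#(M v) : ℝ) ≤ N * T / 2) (t : ℝ) :
    ∃ S ⊆ A, (∑ v ∈ B, (#(M v) : ℝ)) / (2 * N) - t * #A / N ≤
      (∑ v ∈ B with #(M v ∩ S) ≤ T, (#(M v ∩ S) : ℝ)) - t * #S := by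
  have hN : (0 : ℝ) < N := by exact_mod_cast Nat.pos_of_ne_zero (NeZero.ne N)
  have hT' : (0 : ℝ) < T := by exact_mod_cast hT
  let S : (α → Fin N) → Finset α := fun f => {u ∈ A | f u = 0}
  let P : ℝ := N ^ Fintype.card α
  have hP : 0 < P := by positivity
  let x : α → (α → Fin N) → ℝ := fun u f => if f u = 0 then 1 else 0
  have hx1 : ∀ u, ∑ f, x u f = P / N := by
    intro u
    have h := card_functions_eq_zero_on N {u}
    simp only [mem_singleton, forall_eq, card_singleton, pow_one] at h
    rw [eq_div_iff hN.ne']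
    simp only [x, sum_boole]
    exact h
  have hx2 : ∀ u w, ∑ f, x u f * x w f ≤ P / N ^ 2 + if u = w then P / N else 0 := by
    intro u w
    by_cases huw : u = w
    · subst huw
      have : ∀ f, x u f * x u f = x u f := fun f => by simp [x]
      simp only [this, hx1, if_true]
      have : 0 ≤ P / N ^ 2 := by positivity
      linarith
    · have h := card_functions_eq_zero_on N {u, w}
      simp only [mem_insert, mem_singleton, forall_eq_or_imp, forall_eq, card_pair huw] at h
      rw [if_neg huw, add_zero, le_div_iff₀ (by positivity)]
      simp only [x, ite_mul, one_mul, zero_mul, ← ite_and, sum_boole]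
      exact h.le
  have hcard : ∀ v ∈ B, ∀ f, (#(M v ∩ S f) : ℝ) = ∑ u ∈ M v, x u f := by
    intro v hv f
    simp only [x, sum_boole, S]
    congr 2
    ext u
    have := @hM v hv u
    simp only [mem_inter, mem_filter]
    tauto
  have hcardS : ∀ f, (#(S f) : ℝ) = ∑ u ∈ A, x u f := by
    intro f
    simp [x, S]
  have hlow : ∀ f, (∑ v ∈ B, ((1 + 1 / T) * ∑ u ∈ M v, x u f
      - (∑ u ∈ M v, ∑ w ∈ M v, x u f * x w f) / T)) ≤
      ∑ v ∈ B with #(M v ∩ S f) ≤ T, (#(M v ∩ S f) : ℝ) := by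
    intro f
    rw [sum_filter]
    refine sum_le_sum fun v hv => ?_
    rw [← sum_mul_sum, ← hcard v hv f]
    generalize #(M v ∩ S f) = n
    have e : (1 + 1 / T) * (n : ℝ) - n * n / T = n - n * (n - 1) / T := by ring
    rw [e]
    split_ifs with h
    · have : 0 ≤ (n : ℝ) * (n - 1) / T := by
        refine div_nonneg ?_ hT'.le
        rcases Nat.eq_zero_or_pos n with rfl | hn
        · simp
        · have : (1 : ℝ) ≤ n := by exact_mod_cast hn
          nlinarith
      linarith
    · have h' : (T : ℝ) ≤ n - 1 := by
        have : (T : ℝ) + 1 ≤ n := by exact_mod_cast not_le.mp h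
        linarith
      have : (n : ℝ) ≤ n * (n - 1) / T := by
        rw [le_div_iff₀ hT']
        exact mul_le_mul_of_nonneg_left h' n.cast_nonneg
      linarith
  have hterm : ∀ v ∈ B, P * ((#(M v) : ℝ) / (2 * N)) ≤ ∑ f, ((1 + 1 / T) * ∑ u ∈ M v, x u f
      - (∑ u ∈ M v, ∑ w ∈ M v, x u f * x w f) / T) := by
    intro v hv
    have e1 : ∑ f, ∑ u ∈ M v, x u f = #(M v) * (P / N) := by
      rw [sum_comm]
      simp [hx1]
    have e2 : ∑ f, ∑ u ∈ M v, ∑ w ∈ M v, x u f * x w f ≤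
        #(M v) * (#(M v) * (P / N ^ 2) + P / N) := by
      rw [sum_comm]
      calc _ ≤ ∑ u ∈ M v, (#(M v) * (P / N ^ 2) + P / N) := by
            refine sum_le_sum fun u hu => ?_
            rw [sum_comm]
            refine (sum_le_sum fun w _ => hx2 u w).trans ?_
            rw [sum_add_distrib, sum_ite_eq, if_pos hu]
            simp
        _ = _ := by rw [sum_const, nsmul_eq_mul]
    rw [sum_sub_distrib, ← mul_sum, ← sum_div, e1]
    have e3 := div_le_div_of_nonneg_right e2 hT'.le
    refine le_trans ?_ (sub_le_sub_left e3 _)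
    have e4 : (1 + 1 / (T : ℝ)) * (#(M v) * (P / N)) -
        #(M v) * (#(M v) * (P / N ^ 2) + P / N) / T =
        P * (#(M v) / N) * (1 - #(M v) / (N * T)) := by
      field_simp
      ring
    have e5 : (#(M v) : ℝ) / (N * T) ≤ 1 / 2 := by
      rw [div_le_iff₀ (by positivity)]
      linarith [hD v hv]
    have e6 : P * ((#(M v) : ℝ) / (2 * N)) = P * (#(M v) / N) * (1 / 2) := by ring
    rw [e4, e6]
    exact mul_le_mul_of_nonneg_left (by linarith) (by positivity)
  have hsum : ∑ _f : α → Fin N, ((∑ v ∈ B, (#(M v) : ℝ)) / (2 * N) - t * #A / N) ≤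
      ∑ f, ((∑ v ∈ B with #(M v ∩ S f) ≤ T, (#(M v ∩ S f) : ℝ)) - t * #(S f)) := by
    have e1 : ∑ f, t * (#(S f) : ℝ) = P * (t * #A / N) := by
      simp only [hcardS]
      rw [← mul_sum, sum_comm]
      simp only [hx1, sum_const, nsmul_eq_mul]
      ring
    have e2 := (sum_le_sum hterm).trans (sum_comm.trans_le (sum_le_sum fun f _ => hlow f))
    rw [← mul_sum, ← sum_div] at e2
    rw [sum_sub_distrib (fun f => ∑ v ∈ B with #(M v ∩ S f) ≤ T, (#(M v ∩ S f) : ℝ)), e1,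
      sum_const, card_univ, Fintype.card_fun, Fintype.card_fin,
      nsmul_eq_mul, Nat.cast_pow]
    change P * _ ≤ _
    rw [mul_sub]
    linarith
  obtain ⟨f, -, hf⟩ := exists_le_of_sum_le univ_nonempty hsum
  exact ⟨S f, filter_subset _ _, hf⟩

end Sampling

section NearRegular

variable {V : Type*} (G : SimpleGraph V)

/-- If the degrees from `A` are about `a` and those from `B` to `A` about `a * N`, then sampling `A`
balances the two sides. -/
lemma exists_near_regular_of_pair [Fintype V] [DecidableEq V] (A B : Finset V) (a N : ℕ)
    (ha : 0 < a) (hN : 0 < N) (κ : ℝ) (hκ : 0 < κ) (hA : ∀ v ∈ A, ∀ T ⊆ A ∪ B, degIn G v T ≤ 2 * a)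
    (hBA : ∀ v ∈ B, degIn G v A ≤ 2 * (a * N)) (hBB : ∀ v ∈ B, degIn G v B ≤ 64 * a)
    (hpos : 0 < ∑ v ∈ B, degIn G v A)
    (hAcard : (#A * a : ℝ) ≤ κ * (∑ v ∈ B, degIn G v A : ℕ))
    (hBcard : (#B * (a * N) : ℝ) ≤ κ * (∑ v ∈ B, degIn G v A : ℕ)) :
    ∃ s : Finset V, s.Nonempty ∧ (∀ v ∈ s, degIn G v s ≤ 68 * a) ∧
      a / (4 * κ) * #s ≤ (∑ v ∈ s, degIn G v s : ℕ) := by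
  classical
  have : NeZero N := ⟨hN.ne'⟩
  have hN' : (0 : ℝ) < N := by exact_mod_cast hN
  have ha' : (0 : ℝ) < a := by exact_mod_cast ha
  set E := ∑ v ∈ B, degIn G v A with hE
  have hE' : (0 : ℝ) < E := by exact_mod_cast hpos
  have hApos : (0 : ℝ) < #A := by
    rw [Nat.cast_pos, card_pos]
    by_contra h
    rw [not_nonempty_iff_eq_empty] at h
    simp [hE, h, degIn] at hpos
  obtain ⟨S, hSA, hS⟩ := exists_sample A B (fun v => {u ∈ A | G.Adj v u})
    (fun v _ => filter_subset _ _) N (4 * a) (by positivity)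
    (fun v hv => by
      have : (degIn G v A : ℝ) ≤ 2 * (a * N) := by exact_mod_cast hBA v hv
      push_cast
      unfold degIn at this
      linarith) (E / (4 * #A))
  have hinter : ∀ v, #({u ∈ A | G.Adj v u} ∩ S) = degIn G v S := by
    intro v
    rw [filter_inter, inter_eq_right.mpr hSA, degIn]
  have hEsum : ∑ v ∈ B, (#{u ∈ A | G.Adj v u} : ℝ) = E := by
    rw [hE, Nat.cast_sum]
    rfl
  simp only [hinter, hEsum] at hS
  set B' := {v ∈ B | degIn G v S ≤ 4 * a} with hB'
  have hB'B : B' ⊆ B := filter_subset _ _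
  have hlow : a / (4 * κ) * (#S + #B) ≤ ∑ v ∈ B', (degIn G v S : ℝ) := by
    have e1 : (a / (4 * κ) : ℝ) ≤ E / (4 * #A) := by
      rw [div_le_div_iff₀ (by positivity) (by positivity)]
      linarith
    have e2 : a / (4 * κ) * #B ≤ E / (4 * N : ℝ) := by
      rw [div_mul_eq_mul_div, div_le_div_iff₀ (by positivity) (by positivity)]
      linarith
    have e3 : (E : ℝ) / (2 * N) - E / (4 * #A) * #A / N = E / (4 * N) := by
      field_simp
      ring
    rw [e3] at hS
    have e4 := mul_le_mul_of_nonneg_right e1 (#S).cast_nonneg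
    linarith
  have hlow' : 0 < ∑ v ∈ B', (degIn G v S : ℝ) := by
    refine lt_of_lt_of_le ?_ hlow
    have : (0 : ℝ) < #B := by
      rw [Nat.cast_pos, card_pos]
      by_contra h
      rw [not_nonempty_iff_eq_empty] at h
      simp [hE, h] at hpos
    positivity
  have hne : B'.Nonempty := by
    by_contra h
    rw [not_nonempty_iff_eq_empty] at h
    simp [h] at hlow'
  have hsub : S ∪ B' ⊆ A ∪ B := union_subset_union hSA hB'B
  refine ⟨S ∪ B', hne.mono subset_union_right, fun v hv => ?_, ?_⟩
  · rcases mem_union.mp hv with hv | hv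
    · exact (hA v (hSA hv) _ hsub).trans (by lia)
    · have e1 := degIn_union_le G v S B'
      have e2 := (degIn_mono G v hB'B).trans (hBB v (hB'B hv))
      have e3 := (mem_filter.mp hv).2
      lia
  · have e1 : ∑ v ∈ B', degIn G v S ≤ ∑ v ∈ S ∪ B', degIn G v (S ∪ B') :=
      (sum_le_sum fun v _ => degIn_mono G v subset_union_left).trans
        (sum_le_sum_of_subset subset_union_right)
    have e2 : (∑ v ∈ B', (degIn G v S : ℝ)) ≤ (∑ v ∈ S ∪ B', degIn G v (S ∪ B') : ℕ) := by
      exact_mod_cast e1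
    have e3 : (#(S ∪ B') : ℝ) ≤ #S + #B := by
      exact_mod_cast (card_union_le _ _).trans (Nat.add_le_add_left (card_le_card hB'B) _)
    exact (mul_le_mul_of_nonneg_left e3 (by positivity)).trans (hlow.trans e2)

lemma card_image_log_le (W : Finset V) (g : V → ℕ) (hg : ∀ v ∈ W, 0 < g v) (δ L : ℝ) (hδ : 0 < δ)
    (hL : 2 ≤ L) (hmin : ∀ v ∈ W, δ / 2 ≤ g v) (hmax : ∀ v ∈ W, g v ≤ L * δ) :
    (#(W.image fun v => Nat.log 2 (g v)) : ℝ) ≤ 4 * Real.logb 2 L := by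
  have hLlog : 1 ≤ Real.logb 2 L := by
    rw [Real.le_logb_iff_rpow_le one_lt_two (by linarith)]
    simpa using hL
  set x := Real.logb 2 δ with hx
  have hsub : (W.image fun v => (Nat.log 2 (g v) : ℤ)) ⊆
      Finset.Icc ⌈x - 2⌉ ⌊Real.logb 2 L + x⌋ := by
    intro i hi
    obtain ⟨v, hv, rfl⟩ := mem_image.mp hi
    have hgpos : (0 : ℝ) < g v := by exact_mod_cast hg v hv
    have h1 : (2 : ℝ) ^ (Nat.log 2 (g v)) ≤ g v := by
      exact_mod_cast Nat.pow_log_le_self 2 (hg v hv).ne'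
    have h2 : (g v : ℝ) < 2 ^ (Nat.log 2 (g v) + 1) := by
      exact_mod_cast Nat.lt_pow_succ_log_self one_lt_two (g v)
    rw [mem_Icc, Int.ceil_le, Int.le_floor, Int.cast_natCast]
    constructor
    · have h3 : δ ≤ 2 ^ ((Nat.log 2 (g v) : ℝ) + 2) := by
        have := hmin v hv
        rw [Real.rpow_add two_pos, Real.rpow_natCast]
        rw [pow_succ] at h2
        norm_num
        linarith
      have := (Real.logb_le_iff_le_rpow one_lt_two hδ).mpr h3
      linarith
    · rw [hx, ← Real.logb_mul (by positivity) hδ.ne',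
        Real.le_logb_iff_rpow_le one_lt_two (by positivity), Real.rpow_natCast]
      exact h1.trans (hmax v hv)
  have hcard := card_le_card hsub
  have himg : (W.image fun v => (Nat.log 2 (g v) : ℤ)) =
      (W.image fun v => Nat.log 2 (g v)).image (Nat.cast : ℕ → ℤ) := by
    rw [image_image]
    rfl
  rw [himg, card_image_of_injective _ Nat.cast_injective, Int.card_Icc] at hcard
  have h1 := Int.floor_le (Real.logb 2 L + x)
  have h2 := Int.le_ceil (x - 2)
  have h3 : ((⌊Real.logb 2 L + x⌋ + 1 - ⌈x - 2⌉).toNat : ℝ) ≤ Real.logb 2 L + 3 := by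
    rw [← Int.cast_natCast, Int.toNat_eq_max, Int.cast_max]
    push_cast
    exact max_le (by linarith) (by linarith)
  have h4 : (#(W.image fun v => Nat.log 2 (g v)) : ℝ) ≤ _ := Nat.cast_le.mpr hcard
  linarith

/-- A set `W` of maximum average degree `δ` whose degrees fall into `k` dyadic ranges contains an
induced subgraph that is regular up to a factor `O(k ^ 2)`. -/
lemma exists_near_regular [Fintype V] (W : Finset V) (δ : ℝ) (hδ : 0 < δ) (hW : W.Nonempty)
    (havg : (∑ v ∈ W, degIn G v W : ℕ) = δ * #W)
    (hT : ∀ T : Finset V, (∑ v ∈ T, degIn G v T : ℕ) ≤ δ * #T)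
    (hmin : ∀ v ∈ W, δ / 2 ≤ degIn G v W) (k : ℕ)
    (hk : k = #(W.image fun v => Nat.log 2 (degIn G v W))) :
    ∃ s : Finset V, s.Nonempty ∧ ∃ a : ℕ, δ ≤ 4 * a ∧ (∀ v ∈ s, degIn G v s ≤ 68 * a) ∧
      a / (32 * k ^ 2 : ℝ) * #s ≤ (∑ v ∈ s, degIn G v s : ℕ) := by
  classical
  let g : V → ℕ := fun v => degIn G v W
  let l : V → ℕ := fun v => Nat.log 2 (g v)
  have hg : ∀ v ∈ W, 0 < g v := by
    intro v hv
    have := hmin v hv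
    exact_mod_cast (half_pos hδ).trans_le this
  have hl1 : ∀ v ∈ W, 2 ^ l v ≤ g v := fun v hv => Nat.pow_log_le_self 2 (hg v hv).ne'
  have hl2 : ∀ v, g v ≤ 2 * 2 ^ l v := by
    intro v
    have := Nat.lt_pow_succ_log_self one_lt_two (g v)
    rw [pow_succ] at this
    exact this.le.trans_eq (mul_comm _ _)
  let I := W.image l
  have hI : I.Nonempty := hW.image l
  have hkI : k = #I := hk
  have hk1 : (1 : ℝ) ≤ k := by
    rw [hkI]
    exact_mod_cast hI.card_pos
  let C : ℕ → Finset V := fun i => {v ∈ W | l v = i}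
  have hCW : ∀ i, C i ⊆ W := fun i => filter_subset _ _
  let z : V → ℕ := fun v => degIn G v {u ∈ W | l u ≤ l v}
  have hmaps : ∀ v ∈ W, l v ∈ I := fun v hv => mem_image_of_mem l hv
  set m := ∑ v ∈ W, g v with hm
  have hmpos : (0 : ℝ) < m := by
    rw [hm, havg]
    have : (0 : ℝ) < #W := by exact_mod_cast hW.card_pos
    positivity
  have hz : m ≤ 2 * ∑ v ∈ W, z v := by
    have e1 : ∑ v ∈ W, z v = ∑ v ∈ W, degIn G v {u ∈ W | l v ≤ l u} := by
      simp only [z, degIn, card_filter, sum_filter]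
      rw [sum_comm]
      simp only [G.adj_comm]
    have e2 : ∀ v, g v ≤ z v + degIn G v {u ∈ W | l v ≤ l u} := by
      intro v
      refine le_trans (degIn_mono G v fun u hu => ?_) (degIn_union_le G v _ _)
      rcases le_total (l u) (l v) with h | h <;> simp [hu, h]
    have e3 := sum_le_sum fun v (_ : v ∈ W) => e2 v
    rw [sum_add_distrib, ← e1] at e3
    lia
  -- a dyadic class `C j` sending a constant proportion of its degree to lower classes
  obtain ⟨j, hj, hyj⟩ : ∃ j ∈ I, (∑ v ∈ C j, g v : ℕ) / 4 + m / (4 * k : ℝ) ≤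
      (∑ v ∈ C j, z v : ℕ) := by
    refine exists_le_of_sum_le hI ?_
    rw [sum_add_distrib, ← sum_div, ← Nat.cast_sum, ← Nat.cast_sum,
      sum_fiberwise_of_maps_to hmaps, sum_fiberwise_of_maps_to hmaps, sum_const, nsmul_eq_mul,
      ← hkI, ← hm]
    have e : (k : ℝ) * (m / (4 * k)) = m / 4 := by field_simp
    have hz' : (m : ℝ) ≤ 2 * (∑ v ∈ W, z v : ℕ) := by exact_mod_cast hz
    rw [e]
    linarith
  set b := 2 ^ j with hb
  have hbpos : (0 : ℝ) < b := by positivity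
  have hCmass : ∀ i, #(C i) * 2 ^ i ≤ ∑ v ∈ C i, g v := by
    intro i
    rw [← Nat.nsmul_eq_mul]
    refine card_nsmul_le_sum _ _ _ fun v hv => ?_
    obtain ⟨hvW, rfl⟩ := mem_filter.mp hv
    exact hl1 v hvW
  have hBmass : (#(C j) * b : ℝ) ≤ (∑ v ∈ C j, g v : ℕ) := by exact_mod_cast hCmass j
  let B : Finset V := {v ∈ C j | (degIn G v (C j) : ℝ) ≤ 16 * δ}
  let B₀ : Finset V := {v ∈ C j | ¬ (degIn G v (C j) : ℝ) ≤ 16 * δ}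
  have hBC : B ⊆ C j := filter_subset _ _
  have hB₀ : (16 * #B₀ : ℝ) ≤ #(C j) := by
    have e1 : (#B₀ * (16 * δ) : ℝ) ≤ ∑ v ∈ B₀, (degIn G v (C j) : ℝ) := by
      rw [← nsmul_eq_mul]
      exact card_nsmul_le_sum _ _ _ fun v hv => (not_le.mp (mem_filter.mp hv).2).le
    have e2 : ∑ v ∈ B₀, (degIn G v (C j) : ℝ) ≤ ∑ v ∈ C j, (degIn G v (C j) : ℝ) :=
      sum_le_sum_of_subset_of_nonneg (filter_subset _ _) fun _ _ _ => Nat.cast_nonneg _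
    have e3 := hT (C j)
    push_cast at e3
    have e4 : δ * (16 * #B₀) ≤ δ * #(C j) := by linarith
    exact le_of_mul_le_mul_left e4 hδ
  have hzg : ∀ v, z v ≤ g v := fun v => degIn_mono G v (filter_subset _ _)
  have hgC : ∀ i, ∀ v ∈ C i, g v ≤ 2 * 2 ^ i := by
    intro i v hv
    obtain ⟨-, rfl⟩ := mem_filter.mp hv
    exact hl2 v
  have hB₀z : (∑ v ∈ B₀, z v : ℕ) ≤ (#B₀ * (2 * b) : ℝ) := by
    have : ∑ v ∈ B₀, z v ≤ #B₀ * (2 * b) := by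
      rw [← Nat.nsmul_eq_mul]
      exact sum_le_card_nsmul _ _ _ fun v hv => (hzg v).trans (hgC j v (filter_subset _ _ hv))
    exact_mod_cast this
  have hsplit : ((∑ v ∈ B, z v : ℕ) : ℝ) + (∑ v ∈ B₀, z v : ℕ) = (∑ v ∈ C j, z v : ℕ) := by
    exact_mod_cast sum_filter_add_sum_filter_not (C j) _ z
  have hBz1 : (#(C j) * b / 8 : ℝ) ≤ (∑ v ∈ B, z v : ℕ) := by
    have : (0 : ℝ) ≤ m / (4 * k) := by positivity
    have := mul_le_mul_of_nonneg_right hB₀ hbpos.le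
    linarith
  have hBz2 : (m / (8 * k) : ℝ) ≤ (∑ v ∈ B, z v : ℕ) := by
    have := mul_le_mul_of_nonneg_right hB₀ hbpos.le
    have e : (m / (8 * k) : ℝ) = m / (4 * k) / 2 := by ring
    have : (0 : ℝ) ≤ m / (4 * k) := by positivity
    linarith
  -- a lower class `C i` receiving a `1 / k` fraction of these edges
  let I' : Finset ℕ := {i ∈ I | i ≤ j}
  have hI' : I'.Nonempty := ⟨j, mem_filter.mpr ⟨hj, le_rfl⟩⟩
  have hI'k : (#I' : ℝ) ≤ k := by
    rw [hkI]
    exact_mod_cast card_le_card (filter_subset _ _)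
  have hzsum : ∀ v ∈ B, z v = ∑ i ∈ I', degIn G v (C i) := by
    intro v hv
    have hlv : l v = j := (mem_filter.mp (hBC hv)).2
    simp only [z, degIn, hlv]
    rw [card_eq_sum_card_fiberwise (f := l) (t := I')]
    · refine sum_congr rfl fun i hi => ?_
      congr 1
      ext u
      have := (mem_filter.mp hi).2
      simp only [C, mem_filter]
      constructor
      · rintro ⟨⟨⟨h1, -⟩, h2⟩, h3⟩
        exact ⟨⟨h1, h3⟩, h2⟩
      · rintro ⟨⟨h1, h3⟩, h2⟩
        exact ⟨⟨⟨h1, h3 ▸ this⟩, h2⟩, h3⟩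
    · intro u hu
      simp only [coe_filter, mem_filter, Set.mem_ofPred_eq] at hu
      simp only [I', coe_filter, Set.mem_ofPred_eq]
      exact ⟨hmaps u hu.1.1, hu.1.2⟩
  obtain ⟨i, hi, hEi⟩ : ∃ i ∈ I', ((∑ v ∈ B, z v : ℕ) : ℝ) / k ≤ (∑ v ∈ B, degIn G v (C i) : ℕ) := by
    refine exists_le_of_sum_le hI' ?_
    rw [sum_const, nsmul_eq_mul, ← Nat.cast_sum, sum_comm, ← sum_congr rfl hzsum]
    rw [← mul_div_assoc, div_le_iff₀ (by positivity), mul_comm]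
    exact mul_le_mul_of_nonneg_left hI'k (Nat.cast_nonneg _)
  obtain ⟨hiI, hij⟩ := mem_filter.mp hi
  set E := ∑ v ∈ B, degIn G v (C i) with hE
  rw [div_le_iff₀ (by positivity)] at hEi
  have hbN : 2 ^ i * 2 ^ (j - i) = b := by rw [← pow_add, Nat.add_sub_cancel' hij]
  have hδi : δ ≤ 4 * (2 ^ i : ℕ) := by
    obtain ⟨u, hu, hui⟩ := mem_image.mp hiI
    have e1 := hmin u hu
    have e2 : (g u : ℝ) ≤ 2 * (2 ^ i : ℕ) := by
      rw [← hui]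
      exact_mod_cast hl2 u
    simp only [g] at e2
    linarith
  have hBzpos : (0 : ℝ) < (∑ v ∈ B, z v : ℕ) := lt_of_lt_of_le (by positivity) hBz2
  obtain ⟨s, hs, hsmax, hsavg⟩ := exists_near_regular_of_pair G (C i) B (2 ^ i) (2 ^ (j - i))
    (by positivity) (by positivity) (8 * k ^ 2) (by positivity)
    (fun v hv T hTs => (degIn_mono G v (hTs.trans (union_subset (hCW i) (hBC.trans (hCW j))))).trans
      (hgC i v hv))
    (fun v hv => by
      rw [hbN]
      exact (degIn_mono G v (hCW i)).trans (hgC j v (hBC hv)))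
    (fun v hv => by
      have e1 : (degIn G v (C j) : ℝ) ≤ 16 * δ := (mem_filter.mp hv).2
      have e2 : (degIn G v B : ℝ) ≤ degIn G v (C j) := by exact_mod_cast degIn_mono G v hBC
      have e3 : (degIn G v B : ℝ) ≤ 64 * (2 ^ i : ℕ) := by linarith
      exact_mod_cast e3)
    (by
      rw [← hE]
      have : (0 : ℝ) < E := by
        by_contra h
        have := mul_nonpos_of_nonpos_of_nonneg (not_lt.mp h) (k.cast_nonneg (α := ℝ))
        linarith
      exact_mod_cast this)
    (by
      have e1 : (#(C i) * (2 ^ i : ℕ) : ℝ) ≤ m := by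
        exact_mod_cast (hCmass i).trans (sum_le_sum_of_subset (hCW i))
      rw [div_le_iff₀ (by positivity)] at hBz2
      have := mul_le_mul_of_nonneg_right hEi (show (0 : ℝ) ≤ 8 * k by positivity)
      linarith)
    (by
      have e1 : (#B * b : ℝ) ≤ #(C j) * b :=
        mul_le_mul_of_nonneg_right (by exact_mod_cast card_le_card hBC) hbpos.le
      have e2 : ((2 ^ i : ℕ) * (2 ^ (j - i) : ℕ) : ℝ) = b := by exact_mod_cast hbN
      rw [e2, ← hE]
      have e3 : (E * k : ℝ) ≤ E * k * k := le_mul_of_one_le_right (by positivity) hk1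
      linarith)
  refine ⟨s, hs, 2 ^ i, hδi, hsmax, ?_⟩
  convert hsavg using 3
  ring

end NearRegular

/-- There are absolute constants `c, C > 0` such that for all
sufficiently large `L ≥ 2`: every graph with average degree at least `d` and maximum
degree at most `L d` has an induced subgraph `H` with `Δ(H) ≤ C d(H) (log₂ L)²` and
`d(H) ≥ c d / (log₂ L)²`. -/
theorem stmt7 :
    ∃ c C : ℝ, 0 < c ∧ 0 < C ∧ ∃ L₀ : ℝ, ∀ L : ℝ, L₀ ≤ L → 2 ≤ L →
      ∀ (V : Type) [Fintype V] (G : SimpleGraph V) (d : ℝ),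
        avgDeg G ≥ d → (∀ v : V, (deg G v : ℝ) ≤ L * d) →
        ∃ s : Finset V,
          (∀ v, (deg (G.induce (s : Set V)) v : ℝ)
              ≤ C * avgDeg (G.induce (s : Set V)) * (Real.logb 2 L) ^ 2) ∧
          avgDeg (G.induce (s : Set V)) ≥ c * d / (Real.logb 2 L) ^ 2 := by
  refine ⟨1 / 2048, 34816, by norm_num, by norm_num, 2, fun L _ hL V _ G d hd hΔ => ?_⟩
  rcases le_or_gt d 0 with hd0 | hd0
  · refine ⟨∅, fun v => absurd v.2 (by simp), ?_⟩
    rw [avgDeg_induce]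
    simp only [sum_empty, Nat.cast_zero, zero_div]
    exact div_nonpos_of_nonpos_of_nonneg (by linarith) (sq_nonneg _)
  have hne : Nonempty V := by
    by_contra h
    rw [not_nonempty_iff] at h
    simp only [avgDeg, Fintype.card_eq_zero, Nat.cast_zero, div_zero] at hd
    linarith
  obtain ⟨W, hW, δ, hdδ, havg, hT, hmin⟩ := exists_max_average G
  have hδ : 0 < δ := by linarith
  have hδd : d ≤ δ := hd.trans hdδ
  have hmax : ∀ v ∈ W, (degIn G v W : ℝ) ≤ L * δ := by
    intro v _
    have h1 := hΔ v
    rw [deg_eq_degIn] at h1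
    have h2 : (degIn G v W : ℝ) ≤ degIn G v univ := by
      exact_mod_cast degIn_mono G v (subset_univ W)
    have h3 := mul_le_mul_of_nonneg_left hδd (show 0 ≤ L by linarith)
    linarith
  have hg : ∀ v ∈ W, 0 < degIn G v W := fun v hv => by
    exact_mod_cast (half_pos hδ).trans_le (hmin v hv)
  have hk := card_image_log_le W (fun v => degIn G v W) hg δ L hδ hL hmin hmax
  obtain ⟨s, hs, a, hδa, hsmax, hsavg⟩ :=
    exists_near_regular G W δ hδ hW havg hT hmin _ rfl
  set k := #(W.image fun v => Nat.log 2 (degIn G v W))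
  have hkpos : (0 : ℝ) < k := by exact_mod_cast (hW.image _).card_pos
  have hspos : (0 : ℝ) < #s := by exact_mod_cast hs.card_pos
  have hlog : 0 < Real.logb 2 L := by linarith
  have hapos : (0 : ℝ) < a := by linarith
  have hk2 : (k : ℝ) ^ 2 ≤ 16 * Real.logb 2 L ^ 2 := by
    have := pow_le_pow_left₀ hkpos.le hk 2
    linarith [mul_pow 4 (Real.logb 2 L) 2]
  have havgs : a / (512 * Real.logb 2 L ^ 2) ≤ avgDeg (G.induce (s : Set V)) := by
    rw [avgDeg_induce, le_div_iff₀ hspos]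
    refine le_trans (mul_le_mul_of_nonneg_right ?_ hspos.le) hsavg
    exact div_le_div_of_nonneg_left hapos.le (by positivity) (by linarith)
  refine ⟨s, fun v => ?_, ?_⟩
  · rw [deg_induce]
    have h1 : (degIn G v s : ℝ) ≤ 68 * a := by exact_mod_cast hsmax v v.2
    rw [div_le_iff₀ (by positivity)] at havgs
    linarith
  · refine le_trans ?_ havgs
    rw [div_le_div_iff₀ (by positivity) (by positivity)]
    have := mul_le_mul_of_nonneg_right (hδd.trans hδa) (sq_nonneg (Real.logb 2 L))
    linarith
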